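/- Let d ≥ 3 and 0 ≤ m ≤ d. With γ_j = e₁ + e₂ + … + e_j ∈ ℤ^d (the sum of the first j standard basis vectors, γ_0 = 0), the Green's function of the simple random walk on U_m = ℕ₀^m × ℤ^{d−m} at the origin satisfies G_m(0, 0) = Σ_{j=0}^{m} C(m, j) · g(0, γ_j), where C(m,j) is the binomial coefficient and g is the Green's function of the simple random walk on ℤ^d. -/

import Mathlib

open scoped ENNReal
open Filter

noncomputable section

variable {V : Type*}

/-- Total conductance (weight) `π(x) = Σ_y c(x,y)` at a vertex `x`. -/
def piW (c : V → V → ℝ≥0∞) (x : V) : ℝ≥0∞ := ∑' y, c x y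

/-- One-step transition probability `c(x,y)/π(x)` of the random walk with conductances `c`. -/
def step (c : V → V → ℝ≥0∞) (x y : V) : ℝ≥0∞ := c x y / piW c x

/-- `n`-step transition probability of the random walk with conductances `c`. -/
def stepN [DecidableEq V] (c : V → V → ℝ≥0∞) : ℕ → V → V → ℝ≥0∞
  | 0, x, y => if x = y then 1 else 0
  | n + 1, x, y => ∑' z, stepN c n x z * step c z y

/-- Green's function `G(x,y) = π(y)⁻¹ Σ_n p_n(x,y)` of the walk with conductances `c`. -/
def green [DecidableEq V] (c : V → V → ℝ≥0∞) (x y : V) : ℝ≥0∞ :=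
  (piW c y)⁻¹ * ∑' n, stepN c n x y

/-- Nearest-neighbour adjacency on `ℤ^d`. -/
def latAdj {d : ℕ} (x y : Fin d → ℤ) : Prop := (∑ i, (x i - y i).natAbs) = 1

instance {d : ℕ} (x y : Fin d → ℤ) : Decidable (latAdj x y) := by
  unfold latAdj; infer_instance

/-- Unit conductances on `ℤ^d`. -/
def cZ (d : ℕ) (x y : Fin d → ℤ) : ℝ≥0∞ := if latAdj x y then 1 else 0

/-- Green's function of the simple random walk on `ℤ^d`. -/
def g (d : ℕ) : (Fin d → ℤ) → (Fin d → ℤ) → ℝ≥0∞ := green (cZ d)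

/-- Membership in `U_m = ℕ₀^m × ℤ^{d-m}`: the first `m` coordinates are nonnegative. -/
def memU (m : ℕ) {d : ℕ} (x : Fin d → ℤ) : Prop := ∀ i : Fin d, (i : ℕ) < m → 0 ≤ x i

instance (m : ℕ) {d : ℕ} (x : Fin d → ℤ) : Decidable (memU m x) := by
  unfold memU; infer_instance

/-- Unit conductances on the subgraph `U_m` of `ℤ^d`. -/
def cU (d m : ℕ) (x y : Fin d → ℤ) : ℝ≥0∞ :=
  if memU m x ∧ memU m y ∧ latAdj x y then 1 else 0

/-- Green's function `G_m` of the simple random walk on `U_m = ℕ₀^m × ℤ^{d-m}`. -/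
def Gm (d m : ℕ) : (Fin d → ℤ) → (Fin d → ℤ) → ℝ≥0∞ := green (cU d m)

/-- Reflection in the first coordinate: `ȳ = (-y₁, y₂, …, y_d)`. -/
def reflFirst {d : ℕ} (y : Fin d → ℤ) : Fin d → ℤ := fun i => if (i : ℕ) = 0 then -y i else y i

/-- The first standard basis vector of `ℤ^d`. -/
def e1 (d : ℕ) : Fin d → ℤ := fun i => if (i : ℕ) = 0 then 1 else 0


/-- The vector `γ_j = e₁ + … + e_j ∈ ℤ^d` (with `γ_0 = 0`). -/
def gamma {d : ℕ} (j : ℕ) : Fin d → ℤ := fun i => if (i : ℕ) < j then 1 else 0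

section General

theorem piW_equiv (c : V → V → ℝ≥0∞) (σ : V ≃ V) (hσ : ∀ x y, c (σ x) (σ y) = c x y) (x : V) :
    piW c (σ x) = piW c x := by
  unfold piW
  rw [← σ.tsum_eq]
  simp_rw [hσ]

variable [DecidableEq V]

/-- The Green's function summed against a starting measure is a fixed point. -/
theorem piW_mul_tsum_green (c : V → V → ℝ≥0∞) (μ : V → ℝ≥0∞) (y : V)
    (h0 : piW c y ≠ 0) (ht : piW c y ≠ ∞) :
    piW c y * ∑' x, μ x * green c x y =
      μ y + ∑' z, (∑' x, μ x * green c x z) * c z y := by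
  have hL : piW c y * ∑' x, μ x * green c x y = ∑' x, μ x * ∑' n, stepN c n x y := by
    rw [← ENNReal.tsum_mul_left]
    refine tsum_congr fun x => ?_
    rw [green, mul_left_comm, ← mul_assoc (piW c y), ENNReal.mul_inv_cancel h0 ht, one_mul]
  have hR : ∀ z, (∑' x, μ x * green c x z) * c z y =
      ∑' x, μ x * ∑' n, stepN c n x z * step c z y := by
    intro z
    rw [← ENNReal.tsum_mul_right]
    refine tsum_congr fun x => ?_
    rw [ENNReal.tsum_mul_right, green, step, div_eq_mul_inv]
    ring
  rw [hL]
  simp_rw [hR]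
  rw [ENNReal.tsum_comm]
  have h1 : ∀ x, ∑' n, stepN c n x y =
      (if x = y then 1 else 0) + ∑' z, ∑' n, stepN c n x z * step c z y := by
    intro x
    rw [tsum_eq_zero_add' ENNReal.summable, ENNReal.tsum_comm]
    rfl
  simp_rw [h1, mul_add, ENNReal.tsum_add, ENNReal.tsum_mul_left]
  congr 1
  rw [tsum_eq_single y (fun x hx => by simp [hx])]
  simp

/-- The Green's function summed against a starting measure is the least supersolution. -/
theorem tsum_green_le (c : V → V → ℝ≥0∞) (μ h : V → ℝ≥0∞)
    (H : ∀ y, μ y + ∑' z, h z * c z y ≤ piW c y * h y) (y : V) :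
    ∑' x, μ x * green c x y ≤ h y := by
  have key : ∀ N y, ∑ n ∈ Finset.range N, ∑' x, μ x * stepN c n x y ≤ piW c y * h y := by
    intro N
    induction N with
    | zero => intro y; simp
    | succ N ih =>
      intro y
      refine le_trans ?_ (H y)
      rw [Finset.sum_range_succ', add_comm]
      refine add_le_add (le_of_eq ?_) ?_
      · rw [tsum_eq_single y (fun x hx => by simp [stepN, hx])]
        simp [stepN]
      · have h1 : ∀ n, ∑' x, μ x * stepN c (n + 1) x y =
            ∑' z, (∑' x, μ x * stepN c n x z) * step c z y := by
          intro n
          simp_rw [stepN, ← ENNReal.tsum_mul_left, ← ENNReal.tsum_mul_right]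
          rw [ENNReal.tsum_comm]
          simp_rw [mul_assoc]
        simp_rw [h1]
        rw [← Summable.tsum_finsetSum (fun _ _ => ENNReal.summable)]
        refine ENNReal.tsum_le_tsum fun z => ?_
        rw [← Finset.sum_mul]
        calc _ ≤ piW c z * h z * step c z y := by gcongr; exact ih z
          _ = (piW c z * (piW c z)⁻¹) * (h z * c z y) := by
            rw [step, div_eq_mul_inv]; ring
          _ ≤ 1 * (h z * c z y) := by gcongr; exact ENNReal.mul_inv_le_one _
          _ = _ := one_mul _
  have h2 : ∑' x, μ x * green c x y = (piW c y)⁻¹ * ∑' n, ∑' x, μ x * stepN c n x y := by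
    rw [ENNReal.tsum_comm, ← ENNReal.tsum_mul_left]
    refine tsum_congr fun x => ?_
    rw [green, ENNReal.tsum_mul_left]; ring
  rw [h2]
  calc _ ≤ (piW c y)⁻¹ * (piW c y * h y) := by
        gcongr
        exact ENNReal.tsum_le_of_sum_range_le fun N => key N y
    _ = (piW c y * (piW c y)⁻¹) * h y := by ring
    _ ≤ 1 * h y := by gcongr; exact ENNReal.mul_inv_le_one _
    _ = _ := one_mul _

/-- The Green's function is invariant under automorphisms of the network. -/
theorem green_equiv (c : V → V → ℝ≥0∞) (σ : V ≃ V) (hσ : ∀ x y, c (σ x) (σ y) = c x y)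
    (x y : V) : green c (σ x) (σ y) = green c x y := by
  have h : ∀ n y, stepN c n (σ x) (σ y) = stepN c n x y := by
    intro n
    induction n with
    | zero => intro y; simp [stepN]
    | succ n ih =>
      intro y
      simp_rw [stepN]
      rw [← σ.tsum_eq]
      simp_rw [ih, step, hσ, piW_equiv c σ hσ]
  simp_rw [green, piW_equiv c σ hσ, h]

end General

section Lattice

variable {d : ℕ}

theorem latAdj_comm (x y : Fin d → ℤ) : latAdj x y ↔ latAdj y x := by
  unfold latAdj
  have : ∀ i, (x i - y i).natAbs = (y i - x i).natAbs := fun i => by omega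
  simp_rw [this]

theorem cZ_comm (x y : Fin d → ℤ) : cZ d x y = cZ d y x := by
  unfold cZ
  simp_rw [latAdj_comm x y]

theorem cU_comm (m : ℕ) (x y : Fin d → ℤ) : cU d m x y = cU d m y x := by
  unfold cU
  simp_rw [latAdj_comm x y, and_left_comm]

theorem latAdj_single_add (hd : 0 < d) (z : Fin d → ℤ) :
    latAdj z (z + Pi.single (⟨0, hd⟩ : Fin d) 1) := by
  unfold latAdj
  rw [Finset.sum_eq_single (⟨0, hd⟩ : Fin d)]
  · simp
  · intro i _ hi
    simp [hi]
  · simp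

theorem piW_cZ_ne_top (z : Fin d → ℤ) : piW (cZ d) z ≠ ∞ := by
  have hsupp : ∀ w ∉ Finset.Icc (z - 1) (z + 1), cZ d z w = 0 := by
    intro w hw
    unfold cZ
    rw [if_neg]
    intro h
    apply hw
    rw [Finset.mem_Icc]
    unfold latAdj at h
    have hi : ∀ i, (z i - w i).natAbs ≤ 1 := fun i => by
      rw [← h]
      exact Finset.single_le_sum (f := fun i => (z i - w i).natAbs)
        (fun _ _ => Nat.zero_le _) (Finset.mem_univ i)
    constructor <;> intro i <;> have := hi i <;> simp <;> omega
  unfold piW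
  rw [tsum_eq_sum hsupp]
  refine (ENNReal.sum_lt_top.2 fun w _ => ?_).ne
  unfold cZ
  split_ifs <;> simp

theorem piW_cZ_ne_zero (hd : 0 < d) (z : Fin d → ℤ) : piW (cZ d) z ≠ 0 := by
  intro h
  have := ENNReal.tsum_eq_zero.1 h (z + Pi.single (⟨0, hd⟩ : Fin d) 1)
  simp [cZ, latAdj_single_add hd z] at this

theorem piW_cU_ne_zero (hd : 0 < d) {m : ℕ} {z : Fin d → ℤ} (hz : memU m z) :
    piW (cU d m) z ≠ 0 := by
  intro h
  have := ENNReal.tsum_eq_zero.1 h (z + Pi.single (⟨0, hd⟩ : Fin d) 1)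
  have hm : memU m (z + Pi.single (⟨0, hd⟩ : Fin d) 1) := by
    intro i hi
    have h0 := hz i hi
    by_cases hi0 : i = ⟨0, hd⟩
    · subst hi0; simp; omega
    · simp [hi0, h0]
  simp [cU, latAdj_single_add hd z, hz, hm] at this

theorem piW_cU_ne_top (m : ℕ) (z : Fin d → ℤ) : piW (cU d m) z ≠ ∞ := by
  refine ne_top_of_le_ne_top (piW_cZ_ne_top z) (ENNReal.tsum_le_tsum fun w => ?_)
  unfold cU cZ
  split_ifs <;> simp_all

/-- Reflection of the coordinates in `T` about `-1/2`. -/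
def coordFlip (T : Finset (Fin d)) : (Fin d → ℤ) ≃ (Fin d → ℤ) :=
  Function.Involutive.toPerm (fun z i => if i ∈ T then -1 - z i else z i) (by
    intro z
    ext i
    by_cases h : i ∈ T <;> simp [h])

theorem flip_apply (T : Finset (Fin d)) (z : Fin d → ℤ) (i : Fin d) :
    coordFlip T z i = if i ∈ T then -1 - z i else z i := rfl

theorem cZ_coordFlip (T : Finset (Fin d)) (x y : Fin d → ℤ) :
    cZ d (coordFlip T x) (coordFlip T y) = cZ d x y := by
  unfold cZ latAdj
  have : ∀ i, (coordFlip T x i - coordFlip T y i).natAbs = (x i - y i).natAbs := by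
    intro i
    simp only [flip_apply]
    split_ifs <;> omega
  simp_rw [this]

/-- The folding map of `ℤ^d` onto `U_m`, reflecting negative coordinates about `-1/2`. -/
def foldU (m : ℕ) (z : Fin d → ℤ) : Fin d → ℤ :=
  fun i => if (i : ℕ) < m ∧ z i < 0 then -1 - z i else z i

theorem memU_fold (m : ℕ) (z : Fin d → ℤ) : memU m (foldU m z) := by
  intro i hi
  unfold foldU
  split_ifs <;> omega

theorem fold_of_memU {m : ℕ} {z : Fin d → ℤ} (hz : memU m z) : foldU m z = z := by
  ext i
  have := hz i
  unfold foldU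
  split_ifs <;> omega

theorem foldU_coordFlip {m : ℕ} {T : Finset (Fin d)} (hT : ∀ i ∈ T, (i : ℕ) < m) (z : Fin d → ℤ) :
    foldU m (coordFlip T z) = foldU m z := by
  ext i
  have := hT i
  simp only [foldU, flip_apply]
  by_cases hi : i ∈ T
  · have := hT i hi
    simp only [hi, if_true]
    split_ifs <;> omega
  · simp [hi]

theorem exists_flip_eq_fold (m : ℕ) (z : Fin d → ℤ) :
    ∃ T : Finset (Fin d), (∀ i ∈ T, (i : ℕ) < m) ∧ coordFlip T z = foldU m z := by
  refine ⟨Finset.univ.filter fun i : Fin d => (i : ℕ) < m ∧ z i < 0, ?_, ?_⟩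
  · intro i hi
    exact (Finset.mem_filter.1 hi).2.1
  · ext i
    simp [flip_apply, foldU]

/-- A lattice neighbour, outside `U_m`, of a point of `U_m` folds back to that point. -/
theorem fold_of_latAdj {m : ℕ} {w z : Fin d → ℤ} (hz : memU m z) (hw : ¬ memU m w)
    (h : latAdj w z) : foldU m w = z := by
  unfold memU at hw
  push Not at hw
  obtain ⟨i, him, hi⟩ := hw
  have hzi := hz i him
  unfold latAdj at h
  rw [← Finset.add_sum_erase _ _ (Finset.mem_univ i)] at h
  have h0 : ∑ j ∈ Finset.univ.erase i, (w j - z j).natAbs = 0 := by omega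
  rw [Finset.sum_eq_zero_iff] at h0
  ext j
  by_cases hj : j = i
  · subst hj
    unfold foldU
    rw [if_pos ⟨him, hi⟩]
    omega
  · have h1 := h0 j (by simp [hj])
    have h2 := hz j
    unfold foldU
    split_ifs <;> omega

/-- Total conductance from `z` to the complement of `U_m`. -/
def exitW (m : ℕ) (z : Fin d → ℤ) : ℝ≥0∞ := ∑' w, if memU m w then 0 else cZ d w z

theorem tsum_fold_mul_cZ (m : ℕ) (f : (Fin d → ℤ) → ℝ≥0∞) (z : Fin d → ℤ) :
    ∑' w, f (foldU m w) * cZ d w z =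
      ∑' w, f w * cU d m w (foldU m z) + f (foldU m z) * exitW m (foldU m z) := by
  obtain ⟨T, hT, hTz⟩ := exists_flip_eq_fold m z
  have h1 : ∑' w, f (foldU m w) * cZ d w z = ∑' w, f (foldU m w) * cZ d w (foldU m z) := by
    rw [← (coordFlip T).tsum_eq (fun w => f (foldU m w) * cZ d w (foldU m z))]
    simp_rw [foldU_coordFlip hT, ← hTz, cZ_coordFlip]
  rw [h1, exitW, ← ENNReal.tsum_mul_left, ← ENNReal.tsum_add]
  have hz := memU_fold m z
  refine tsum_congr fun w => ?_
  by_cases hw : memU m w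
  · simp [hw, hz, cU, cZ, fold_of_memU hw]
  · by_cases hadj : latAdj w (foldU m z)
    · simp [hw, cU, fold_of_latAdj hz hw hadj]
    · simp [hw, cU, cZ, hadj]

theorem piW_cZ_eq_add (m : ℕ) (z : Fin d → ℤ) :
    piW (cZ d) z = piW (cU d m) (foldU m z) + exitW m (foldU m z) := by
  have := tsum_fold_mul_cZ m (fun _ => 1) z
  simp only [one_mul] at this
  unfold piW
  simp_rw [cZ_comm z, cU_comm m (foldU m z), this]

theorem tsum_fold_mul_g (hd : 0 < d) (m : ℕ) :
    ∑' x, (if foldU m x = 0 then 1 else 0) * g d x 0 = Gm d m 0 0 := by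
  have h0 : memU m (0 : Fin d → ℤ) := fun _ _ => le_rfl
  have hδ : ∀ y, ∑' x, (if x = 0 then 1 else 0) * Gm d m x y = Gm d m 0 y := by
    intro y
    rw [tsum_eq_single 0 (fun x hx => by simp [hx])]
    simp
  set Q : (Fin d → ℤ) → ℝ≥0∞ :=
    fun z => ∑' x, (if foldU m x = 0 then 1 else 0) * g d x z with hQ
  have hQfold : ∀ z, Q (foldU m z) = Q z := by
    intro z
    obtain ⟨T, hT, hTz⟩ := exists_flip_eq_fold m z
    simp only [hQ]
    rw [← (coordFlip T).tsum_eq]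
    simp_rw [foldU_coordFlip hT, ← hTz, g, green_equiv _ _ (cZ_coordFlip T)]
  refine le_antisymm ?_ ?_
  · have := tsum_green_le (cZ d) (fun x => if foldU m x = 0 then 1 else 0)
      (fun z => Gm d m 0 (foldU m z)) (fun z => ?_) 0
    · simpa [fold_of_memU h0, g] using this
    · have h1 := piW_mul_tsum_green (cU d m) (fun x => if x = 0 then 1 else 0) (foldU m z)
        (piW_cU_ne_zero hd (memU_fold m z)) (piW_cU_ne_top m _)
      change piW (cU d m) (foldU m z) * ∑' x, (if x = 0 then 1 else 0) * Gm d m x (foldU m z) =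
        (if foldU m z = 0 then 1 else 0) +
          ∑' w, (∑' x, (if x = 0 then 1 else 0) * Gm d m x w) * cU d m w (foldU m z) at h1
      simp_rw [hδ] at h1
      rw [tsum_fold_mul_cZ m (fun w => Gm d m 0 w), piW_cZ_eq_add m, ← add_assoc, ← h1, add_mul,
        mul_comm (exitW _ _)]
  · change _ ≤ Q 0
    rw [← hδ 0]
    refine tsum_green_le (cU d m) (fun x => if x = 0 then 1 else 0) Q (fun y => ?_) 0
    by_cases hy : memU m y
    · by_cases htop : Q y = ∞
      · rw [htop, ENNReal.mul_top (piW_cU_ne_zero hd hy)]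
        exact le_top
      · have h1 : piW (cZ d) y * Q y = (if foldU m y = 0 then 1 else 0) + ∑' z, Q z * cZ d z y :=
          piW_mul_tsum_green (cZ d) (fun x => if foldU m x = 0 then 1 else 0) y
            (piW_cZ_ne_zero hd y) (piW_cZ_ne_top y)
        have h2 := tsum_fold_mul_cZ m Q y
        have h3 := piW_cZ_eq_add m y
        simp_rw [hQfold] at h2
        simp_rw [fold_of_memU hy] at h1 h2 h3
        have h4 : exitW m y ≠ ∞ := by
          refine ne_top_of_le_ne_top (piW_cZ_ne_top y) ?_
          rw [h3]
          exact le_add_self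
        rw [h2, h3, ← add_assoc, add_mul, mul_comm (exitW m y)] at h1
        exact ((ENNReal.add_left_inj (ENNReal.mul_ne_top htop h4)).1 h1).ge
    · have hy0 : y ≠ 0 := fun h => hy (h ▸ h0)
      simp [cU, hy, hy0]

theorem g_neg_indicator (S : Finset (Fin d)) :
    g d (fun i => if i ∈ S then -1 else 0) 0 = g d 0 (gamma S.card) := by
  have hcd : S.card ≤ d := by simpa using S.card_le_univ
  have hcard : Fintype.card {i : Fin d // i ∈ S} =
      Fintype.card {i : Fin d // (i : ℕ) < S.card} := by
    rw [Fintype.card_coe, Fintype.card_subtype, Fin.card_filter_val_lt, min_eq_right hcd]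
  let e : Equiv.Perm (Fin d) := (Fintype.equivOfCardEq hcard).extendSubtype
  have he : ∀ i, i ∈ S ↔ ((e i : Fin d) : ℕ) < S.card := fun i =>
    ⟨fun h => (Fintype.equivOfCardEq hcard).extendSubtype_mem i h,
      fun h => by_contra fun h' => (Fintype.equivOfCardEq hcard).extendSubtype_not_mem i h' h⟩
  let σ : (Fin d → ℤ) ≃ (Fin d → ℤ) :=
    (Equiv.addRight (fun i => if i ∈ S then (1 : ℤ) else 0)).trans (e.arrowCongr (Equiv.refl ℤ))
  have hσ : ∀ x i, σ x (e i) = x i + if i ∈ S then 1 else 0 := by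
    intro x i
    simp [σ]
  have hc : ∀ x y, cZ d (σ x) (σ y) = cZ d x y := by
    intro x y
    have hadj : latAdj (σ x) (σ y) ↔ latAdj x y := by
      unfold latAdj
      rw [← Equiv.sum_comp e]
      simp_rw [hσ, add_sub_add_right_eq_sub]
    unfold cZ
    simp_rw [hadj]
  rw [g, ← green_equiv _ σ hc]
  congr 1
  · ext i
    obtain ⟨i, rfl⟩ := e.surjective i
    rw [hσ]
    by_cases h : i ∈ S <;> simp [h]
  · ext i
    obtain ⟨i, rfl⟩ := e.surjective i
    rw [hσ]
    simp [gamma, he]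

theorem tsum_fold_eq_sum_powerset (m : ℕ) (f : (Fin d → ℤ) → ℝ≥0∞) :
    ∑' x, (if foldU m x = 0 then 1 else 0) * f x =
      ∑ S ∈ (Finset.univ.filter fun i : Fin d => (i : ℕ) < m).powerset,
        f (fun i => if i ∈ S then -1 else 0) := by
  have hinj : Function.Injective
      (fun (S : Finset (Fin d)) (i : Fin d) => if i ∈ S then (-1 : ℤ) else 0) := by
    intro S S' h
    ext i
    have := congrFun h i
    by_cases h1 : i ∈ S <;> by_cases h2 : i ∈ S' <;> simp_all
  rw [tsum_eq_sum (s := (Finset.univ.filter fun i : Fin d => (i : ℕ) < m).powerset.map ⟨_, hinj⟩)]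
  · rw [Finset.sum_map]
    refine Finset.sum_congr rfl fun S hS => ?_
    have hS' : ∀ i ∈ S, (i : ℕ) < m := fun i hi => by
      simpa using Finset.mem_powerset.1 hS hi
    rw [if_pos, one_mul]
    · rfl
    · ext i
      have := hS' i
      by_cases h : i ∈ S <;> simp_all [foldU]
  · intro x hx
    rw [if_neg, zero_mul]
    intro h0
    apply hx
    refine Finset.mem_map.2 ⟨Finset.univ.filter fun i : Fin d => (i : ℕ) < m ∧ x i < 0, ?_, ?_⟩
    · rw [Finset.mem_powerset]
      intro i hi
      simp_all
    · ext i
      have := congrFun h0 i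
      simp only [foldU, Pi.zero_apply] at this
      simp only [Function.Embedding.coeFn_mk, Finset.mem_filter, Finset.mem_univ, true_and]
      split_ifs at this ⊢ <;> omega

end Lattice

/-- For `d ≥ 3` and `0 ≤ m ≤ d`, the Green's function of `U_m = ℕ₀^m × ℤ^{d-m}` at the
origin satisfies `G_m(0,0) = Σ_{j=0}^m C(m,j) g(0,γ_j)`. -/
theorem green_Um_origin_binomial (d : ℕ) (hd : 3 ≤ d) (m : ℕ) (hm : m ≤ d) :
    Gm d m 0 0 = ∑ j ∈ Finset.range (m + 1), (m.choose j : ℝ≥0∞) * g d 0 (gamma j) := by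
  rw [← tsum_fold_mul_g (by omega) m, tsum_fold_eq_sum_powerset m (fun x => g d x 0)]
  simp_rw [g_neg_indicator]
  rw [Finset.sum_powerset_apply_card (fun j => g d 0 (gamma j)), Fin.card_filter_val_lt,
    min_eq_right hm]
  simp_rw [nsmul_eq_mul]

end
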